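/- Let d ≥ 1 and σ ∈ ℝ. There exist constants C₀ ≥ 1 and ε* ∈ (0,1), depending only on d and σ, with the following properties. For each integer k ≥ 1 set g_k(ξ) = k^{d/2} 𝟙_{B(0,1/k)}(ξ), the scaled indicator of the Euclidean ball of radius 1/k. Then: (a) for every s ≤ 0 and every k ≥ 1, ‖⟨ξ⟩^σ 2^{s‖ξ‖₁} g_k‖_{L²(ℝ^d)} ≤ C₀; (b) for every b < 0, every k ≥ 1 and every ε ∈ (0, ε*], if ‖⟨ξ⟩^σ 2^{b‖ξ‖₁} g_k‖_{L²(ℝ^d)} ≤ ε then −b ≥ C₀^{−1} k log₂(1/ε). -/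

import Mathlib

open MeasureTheory
open scoped ENNReal BigOperators

/-- The weighted `L²`-quantity `‖⟨ξ⟩^σ 2^{b‖ξ‖₁} g‖_{L²(ℝ^d)}` for a real-valued `g`. -/
noncomputable def wNorm (d : ℕ) (σ b : ℝ) (g : EuclideanSpace ℝ (Fin d) → ℝ) : ℝ≥0∞ :=
  (∫⁻ ξ, ENNReal.ofReal
      ((1 + ‖ξ‖ ^ 2) ^ σ * (2 : ℝ) ^ (2 * b * ∑ i, |ξ i|) * (g ξ) ^ 2)) ^ (1/2 : ℝ)

lemma ball_int (d : ℕ) (hd : 1 ≤ d) (k : ℕ) (hk : 1 ≤ k) (A : ℝ) (hA : 0 ≤ A) :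
    ∫⁻ ξ : EuclideanSpace ℝ (Fin d), (Metric.ball (0 : EuclideanSpace ℝ (Fin d)) (1/(k:ℝ))).indicator
      (fun _ => ENNReal.ofReal (A * (k:ℝ)^d)) ξ =
    ENNReal.ofReal (A * (volume (Metric.ball (0 : EuclideanSpace ℝ (Fin d)) 1)).toReal) := by
  have hk' : (0:ℝ) < k := by exact_mod_cast hk
  rw [lintegral_indicator_const Metric.isOpen_ball.measurableSet,
    Measure.addHaar_ball_of_pos _ _ (by positivity)]
  rw [finrank_euclideanSpace_fin, ← mul_assoc, ← ENNReal.ofReal_mul (by positivity),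
    ENNReal.ofReal_mul hA, ENNReal.ofReal_toReal measure_ball_lt_top.ne]
  congr 2
  rw [mul_assoc, ← mul_pow, mul_one_div_cancel hk'.ne', one_pow, mul_one]

lemma sq_rpow_half (d k : ℕ) : ((k:ℝ) ^ ((d : ℝ)/2))^2 = (k:ℝ)^d := by
  rw [← Real.rpow_natCast, ← Real.rpow_mul (by positivity), ← Real.rpow_natCast]
  congr 1
  push_cast
  ring

lemma jap_bounds (σ x : ℝ) (h0 : 0 ≤ x) (h1 : x ≤ 1) :
    (2:ℝ) ^ (-|σ|) ≤ (1 + x ^ 2) ^ σ ∧ (1 + x ^ 2) ^ σ ≤ (2:ℝ) ^ |σ| := by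
  have h2 : 1 + x^2 ≤ 2 := by nlinarith
  have h3 : 1 ≤ 1 + x^2 := by nlinarith
  constructor
  · calc (2:ℝ) ^ (-|σ|) ≤ (1 + x^2) ^ (-|σ|) :=
        Real.rpow_le_rpow_of_nonpos (by linarith) h2 (by simp)
      _ ≤ _ := Real.rpow_le_rpow_of_exponent_le h3 (neg_abs_le σ)
  · calc (1 + x^2) ^ σ ≤ (1 + x^2) ^ |σ| := Real.rpow_le_rpow_of_exponent_le h3 (le_abs_self σ)
      _ ≤ _ := Real.rpow_le_rpow (by linarith) h2 (abs_nonneg σ)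

lemma wNorm_sq_le {I : ℝ≥0∞} {c : ℝ} (hc : 0 ≤ c) :
    I ^ (1/2 : ℝ) ≤ ENNReal.ofReal c ↔ I ≤ ENNReal.ofReal (c^2) := by
  rw [one_div, ENNReal.rpow_inv_le_iff (by norm_num), ENNReal.ofReal_rpow_of_nonneg hc (by norm_num)]
  norm_num

/-- **Lemma 5.1.** With `g_k = k^{d/2} 𝟙_{B(0,1/k)}`: (a) `‖⟨ξ⟩^σ 2^{s‖ξ‖₁} g_k‖_{L²} ≤ C₀`
for every `s ≤ 0` and `k ≥ 1`; (b) if `b < 0`, `ε ∈ (0, ε*]` and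
`‖⟨ξ⟩^σ 2^{b‖ξ‖₁} g_k‖_{L²} ≤ ε`, then `-b ≥ C₀⁻¹ k log₂(1/ε)`. -/
theorem stmt_13 (d : ℕ) (hd : 1 ≤ d) (σ : ℝ) :
    ∃ C₀ : ℝ, 1 ≤ C₀ ∧ ∃ εstar : ℝ, εstar ∈ Set.Ioo (0 : ℝ) 1 ∧
      ((∀ s : ℝ, s ≤ 0 → ∀ k : ℕ, 1 ≤ k →
          wNorm d σ s
              (fun ξ => if ‖ξ‖ < 1/(k : ℝ) then (k : ℝ) ^ ((d : ℝ)/2) else 0)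
            ≤ ENNReal.ofReal C₀) ∧
        (∀ b : ℝ, b < 0 → ∀ k : ℕ, 1 ≤ k → ∀ ε : ℝ, ε ∈ Set.Ioc (0 : ℝ) εstar →
          wNorm d σ b
              (fun ξ => if ‖ξ‖ < 1/(k : ℝ) then (k : ℝ) ^ ((d : ℝ)/2) else 0)
            ≤ ENNReal.ofReal ε →
          C₀⁻¹ * (k : ℝ) * Real.logb 2 (1/ε) ≤ -b)) := by
  set V : ℝ := (volume (Metric.ball (0 : EuclideanSpace ℝ (Fin d)) 1)).toReal with hV
  have hVpos : 0 < V :=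
    ENNReal.toReal_pos (Metric.measure_ball_pos _ _ one_pos).ne' measure_ball_lt_top.ne
  have hd' : (1:ℝ) ≤ d := by exact_mod_cast hd
  have hM : (0:ℝ) < 2 ^ |σ| := by positivity
  have hm : (0:ℝ) < 2 ^ (-|σ|) := by positivity
  have hMV : 0 < (2:ℝ) ^ |σ| * V := by positivity
  have hmV : 0 < (2:ℝ) ^ (-|σ|) * V := by positivity
  refine ⟨1 + 2 * d + 2 ^ |σ| * V, by linarith, min (1/2) (2 ^ (-|σ|) * V),
    ⟨lt_min (by norm_num) hmV, (min_le_left _ _).trans_lt (by norm_num)⟩, ?_, ?_⟩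
  · intro s hs k hk
    have hk1 : (1:ℝ) ≤ k := by exact_mod_cast hk
    unfold wNorm
    rw [wNorm_sq_le (by linarith)]
    refine le_trans (b := ENNReal.ofReal (2 ^ |σ| * V)) ?_ (ENNReal.ofReal_le_ofReal (by nlinarith))
    rw [hV, ← ball_int d hd k hk _ hM.le]
    refine lintegral_mono fun ξ => ?_
    by_cases h : ‖ξ‖ < 1/(k:ℝ)
    · have h1 : ‖ξ‖ ≤ 1 := h.le.trans (by rw [div_le_one (by linarith)]; exact hk1)
      rw [Set.indicator_of_mem (by simpa using h)]
      simp only [h, if_true, sq_rpow_half]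
      refine ENNReal.ofReal_le_ofReal (mul_le_mul_of_nonneg_right ?_ (by positivity))
      refine (mul_le_of_le_one_right (by positivity) ?_).trans (jap_bounds σ _ (norm_nonneg _) h1).2
      refine Real.rpow_le_one_of_one_le_of_nonpos (by norm_num) ?_
      exact mul_nonpos_of_nonpos_of_nonneg (by linarith) (Finset.sum_nonneg fun i _ => abs_nonneg _)
    · rw [Set.indicator_of_notMem (by simpa using h)]; simp only [h, if_false]; simp
  · intro b hb k hk ε ⟨hε, hε1⟩ hle
    have hk1 : (1:ℝ) ≤ k := by exact_mod_cast hk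
    unfold wNorm at hle
    rw [wNorm_sq_le hε.le] at hle
    have hP : (0:ℝ) < 2 ^ (2 * b * (d / k)) := by positivity
    have key : ENNReal.ofReal (2 ^ (-|σ|) * 2 ^ (2 * b * (d / k)) * V) ≤ ENNReal.ofReal (ε^2) := by
      refine le_trans ?_ hle
      rw [hV, ← ball_int d hd k hk _ (by positivity)]
      refine lintegral_mono fun ξ => ?_
      by_cases h : ‖ξ‖ < 1/(k:ℝ)
      · have h1 : ‖ξ‖ ≤ 1 := h.le.trans (by rw [div_le_one (by linarith)]; exact hk1)
        rw [Set.indicator_of_mem (by simpa using h)]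
        simp only [h, if_true, sq_rpow_half]
        refine ENNReal.ofReal_le_ofReal (mul_le_mul_of_nonneg_right ?_ (by positivity))
        refine mul_le_mul (jap_bounds σ _ (norm_nonneg _) h1).1 ?_ (by positivity) (by positivity)
        refine Real.rpow_le_rpow_of_exponent_le (by norm_num) ?_
        refine mul_le_mul_of_nonpos_left ?_ (by linarith)
        calc ∑ i, |ξ i| ≤ ∑ i : Fin d, 1/(k:ℝ) := Finset.sum_le_sum fun i _ =>
              (PiLp.norm_apply_le ξ i).trans h.le
          _ = d / k := by simp [div_eq_mul_inv]
      · rw [Set.indicator_of_notMem (by simpa using h)]; simp only [h, if_false]; simp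
    rw [ENNReal.ofReal_le_ofReal_iff (by positivity)] at key
    have h2 : (2:ℝ) ^ (2 * b * (d / k)) ≤ ε := by
      have h3 : ε ≤ 2 ^ (-|σ|) * V := hε1.trans (min_le_right _ _)
      have h4 := mul_le_mul_of_nonneg_right h3 hP.le
      have : ε * 2 ^ (2 * b * (d / k)) ≤ ε * ε := by nlinarith
      exact le_of_mul_le_mul_left this hε
    have h5 : 2 * b * (d / k) ≤ Real.logb 2 ε := by
      rwa [Real.le_logb_iff_rpow_le (by norm_num) hε]
    have hL : Real.logb 2 (1/ε) = - Real.logb 2 ε := by rw [one_div, Real.logb_inv]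
    have h6 : (k:ℝ) * Real.logb 2 (1/ε) ≤ 2 * d * (-b) := by
      rw [hL]
      have := mul_le_mul_of_nonneg_left h5 (show (0:ℝ) ≤ k by linarith)
      have e : (k:ℝ) * (2 * b * (d / k)) = 2 * b * d := by field_simp
      linarith
    rw [mul_assoc, inv_mul_le_iff₀ (by linarith)]
    nlinarith
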